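/- arXiv:1405.5566 — 3 statements merged into one kernel-verified Lean document; each statement's English description precedes it below -/
import Mathlib

section
/- Let r ≥ 2 and s ∈ ℕ₀. For any finite sequence of complex numbers (a_j)_{0 ≤ j ≤ 2^s}, the r-variational seminorm satisfies V_r(a_j : 0 ≤ j ≤ 2^s) ≤ √2 · Σ_{i=0}^{s} ( Σ_{j=0}^{2^{s-i}-1} |a_{(j+1)2^i} − a_{j 2^i}|² )^{1/2}. -/
open scoped ENNReal NNReal

/-- The `r`-variational seminorm of the sequence `a` restricted to the index set `A`:
the supremum over all finite increasing sequences `u 0 < u 1 < … < u J` in `A` of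
`(∑_{j=1}^J |a (u j) − a (u (j-1))|^r)^(1/r)`. -/
noncomputable def vrOn (r : ℝ) (A : Set ℕ) (a : ℕ → ℂ) : ℝ≥0∞ :=
  ⨆ (J : ℕ) (u : Fin (J + 1) → ℕ) (_ : StrictMono u) (_ : ∀ j, u j ∈ A),
    (∑ j : Fin J, (‖a (u j.succ) - a (u j.castSucc)‖₊ : ℝ≥0∞) ^ r) ^ r⁻¹

lemma aux_disj {ι : Type*} [Fintype ι] [LinearOrder ι] (l h : ι → ℕ) (N : ℕ)
    (hN : ∀ j, h j ≤ N) (hd : ∀ i j, i < j → h i ≤ l j) (f : ℕ → ℝ≥0∞) :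
    ∑ j, ∑ k ∈ Finset.Ico (l j) (h j), f k ≤ ∑ k ∈ Finset.range N, f k := by
  rw [← Finset.sum_biUnion]
  · apply Finset.sum_le_sum_of_subset
    intro k hk
    simp only [Finset.mem_biUnion, Finset.mem_Ico, Finset.mem_range] at hk ⊢
    obtain ⟨j, _, hj⟩ := hk
    have := hN j
    omega
  · intro i _ j _ hij
    rw [Function.onFun, Finset.disjoint_left]
    intro k hk hk'
    rw [Finset.mem_Ico] at hk hk'
    rcases lt_or_gt_of_ne hij with h1 | h1
    · have := hd _ _ h1
      omega
    · have := hd _ _ h1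
      omega

lemma aux_lr {ι : Type*} (S : Finset ι) (r : ℝ) (hr : 2 ≤ r) (x : ι → ℝ≥0∞) :
    (∑ j ∈ S, x j ^ r) ^ r⁻¹ ≤ (∑ j ∈ S, x j ^ (2 : ℝ)) ^ (2 : ℝ)⁻¹ := by
  classical
  induction S using Finset.induction_on with
  | empty => simp [show 0 < r by linarith]
  | insert i S hi ih =>
    rw [Finset.sum_insert hi, Finset.sum_insert hi]
    have h0 : r ≠ 0 := by linarith
    have e1 : (∑ j ∈ S, x j ^ r) = ((∑ j ∈ S, x j ^ r) ^ r⁻¹) ^ r := by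
      rw [ENNReal.rpow_inv_rpow h0]
    have e2 : (∑ j ∈ S, x j ^ (2:ℝ)) = ((∑ j ∈ S, x j ^ (2:ℝ)) ^ (2:ℝ)⁻¹) ^ (2:ℝ) := by
      rw [ENNReal.rpow_inv_rpow (by norm_num)]
    have := ENNReal.rpow_add_rpow_le (p := 2) (q := r) (x i)
      ((∑ j ∈ S, x j ^ (2:ℝ)) ^ (2:ℝ)⁻¹) (by norm_num) hr
    rw [one_div, one_div, ← e2] at this
    refine le_trans ?_ this
    gcongr ?_ ^ _
    gcongr
    rw [e1]
    gcongr

lemma aux_sq (x y : ℝ≥0∞) : (x + y) ^ (2:ℝ) ≤ 2 * (x ^ (2:ℝ) + y ^ (2:ℝ)) := by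
  have := ENNReal.rpow_add_le_mul_rpow_add_rpow x y (p := 2) (by norm_num)
  norm_num at this ⊢
  exact this

lemma aux_step (a : ℕ → ℂ) (l h : ℕ) (hl : l ≤ h) :
    ∃ z : ℝ≥0∞, ‖a h - a l‖ₑ ≤ ‖a (2 * (h / 2)) - a (2 * min ((l + 1) / 2) (h / 2))‖ₑ + z ∧
      z ^ (2:ℝ) ≤ 2 * ∑ k ∈ Finset.Ico l h, ‖a (k + 1) - a k‖ₑ ^ (2:ℝ) := by
  rcases hl.eq_or_lt with rfl | hlt
  · exact ⟨0, by simp, by simp⟩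
  have hm : min ((l + 1) / 2) (h / 2) = (l + 1) / 2 := by omega
  rw [hm]
  set S := ∑ k ∈ Finset.Ico l h, ‖a (k + 1) - a k‖ₑ ^ (2:ℝ) with hS
  refine ⟨‖a h - a (2 * (h / 2))‖ₑ + ‖a (2 * ((l + 1) / 2)) - a l‖ₑ, ?_, ?_⟩
  · have : a h - a l = (a (2 * (h / 2)) - a (2 * ((l + 1) / 2))) +
      ((a h - a (2 * (h / 2))) + (a (2 * ((l + 1) / 2)) - a l)) := by ring
    rw [this]
    exact (enorm_add_le _ _).trans (by gcongr; exact enorm_add_le _ _)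
  · refine (aux_sq _ _).trans ?_
    gcongr
    have mem : ∀ k, l ≤ k → k < h → ‖a (k + 1) - a k‖ₑ ^ (2:ℝ) ≤ S := fun k h1 h2 =>
      Finset.single_le_sum (f := fun k => ‖a (k + 1) - a k‖ₑ ^ (2:ℝ)) (fun _ _ => zero_le)
        (Finset.mem_Ico.2 ⟨h1, h2⟩)
    rcases Nat.even_or_odd' h with ⟨m, rfl | rfl⟩ <;> rcases Nat.even_or_odd' l with ⟨n, rfl | rfl⟩
    · have h1 : 2 * m / 2 = m := by omega
      have h2 : (2 * n + 1) / 2 = n := by omega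
      rw [h1, h2]
      simp
    · have h1 : 2 * m / 2 = m := by omega
      have h2 : 2 * ((2 * n + 1 + 1) / 2) = 2 * n + 1 + 1 := by omega
      rw [h1, h2]
      simpa using mem (2 * n + 1) le_rfl hlt
    · have h1 : (2 * m + 1) / 2 = m := by omega
      have h2 : (2 * n + 1) / 2 = n := by omega
      rw [h1, h2]
      simpa using mem (2 * m) (by omega) (by omega)
    · have h1 : (2 * m + 1) / 2 = m := by omega
      have h2 : 2 * ((2 * n + 1 + 1) / 2) = 2 * n + 1 + 1 := by omega
      rw [h1, h2]
      have hne : 2 * m ≠ 2 * n + 1 := by omega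
      rw [← Finset.sum_pair (f := fun k => ‖a (k + 1) - a k‖ₑ ^ (2:ℝ)) hne, hS]
      apply Finset.sum_le_sum_of_subset
      intro k hk
      simp only [Finset.mem_insert, Finset.mem_singleton, Finset.mem_Ico] at hk ⊢
      omega

lemma aux_sqrt (T : ℝ≥0∞) : (2 * T) ^ (2:ℝ)⁻¹ = ENNReal.ofReal (Real.sqrt 2) * T ^ (2:ℝ)⁻¹ := by
  rw [ENNReal.mul_rpow_of_nonneg _ _ (by norm_num), Real.sqrt_eq_rpow,
    ← ENNReal.ofReal_rpow_of_pos (by norm_num)]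
  norm_num

lemma aux_main {ι : Type*} [Fintype ι] [LinearOrder ι] (s : ℕ) : ∀ (a : ℕ → ℂ) (l h : ι → ℕ)
    (_ : ∀ j, l j ≤ h j) (_ : ∀ j, h j ≤ 2 ^ s) (_ : ∀ i j, i < j → h i ≤ l j),
    (∑ j, ‖a (h j) - a (l j)‖ₑ ^ (2:ℝ)) ^ (2:ℝ)⁻¹ ≤
      ENNReal.ofReal (Real.sqrt 2) *
        ∑ i ∈ Finset.range (s + 1),
          (∑ j ∈ Finset.range (2 ^ (s - i)),
              ‖a ((j + 1) * 2 ^ i) - a (j * 2 ^ i)‖ₑ ^ (2 : ℝ)) ^ ((2 : ℝ)⁻¹) := by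
  induction s with
  | zero =>
    intro a l h hl hN hd
    have key := aux_disj l h _ hN hd (fun k => ‖a (k + 1) - a k‖ₑ ^ (2:ℝ))
    rw [Finset.sum_range_one, ← aux_sqrt]
    gcongr ?_ ^ _
    simp only [pow_zero, mul_one, Nat.sub_zero] at key ⊢
    refine (le_trans ?_ key).trans (le_mul_of_one_le_left zero_le (by norm_num))
    gcongr with j
    have h1 := hl j
    have h2 := hN j
    rcases h1.eq_or_lt with e | e
    · rw [e]; simp
    · have e1 : l j = 0 := by omega
      have e2 : h j = 1 := by omega
      rw [e1, e2]; simp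
  | succ s ih =>
    intro a l h hl hN hd
    choose z hz1 hz2 using fun j => aux_step a (l j) (h j) (hl j)
    have hih := ih (fun n => a (2 * n)) (fun j => min ((l j + 1) / 2) (h j / 2)) (fun j => h j / 2)
      (fun j => min_le_right _ _) (fun j => by have := hN j; rw [pow_succ] at this; omega)
      (fun i j hij => by
        have := hd i j hij
        have := hl j
        simp only [le_min_iff]
        omega)
    have key := aux_disj l h _ hN hd (fun k => ‖a (k + 1) - a k‖ₑ ^ (2:ℝ))
    rw [Finset.sum_range_succ', mul_add]
    calc _ ≤ (∑ j, (‖a (2 * (h j / 2)) - a (2 * min ((l j + 1) / 2) (h j / 2))‖ₑ + z j)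
              ^ (2:ℝ)) ^ (2:ℝ)⁻¹ := by
          gcongr with j
          exact hz1 j
      _ ≤ (∑ j, ‖a (2 * (h j / 2)) - a (2 * min ((l j + 1) / 2) (h j / 2))‖ₑ ^ (2:ℝ)) ^ (2:ℝ)⁻¹ +
            (∑ j, z j ^ (2:ℝ)) ^ (2:ℝ)⁻¹ := by
          have := ENNReal.Lp_add_le (p := 2) Finset.univ
            (fun j => ‖a (2 * (h j / 2)) - a (2 * min ((l j + 1) / 2) (h j / 2))‖ₑ) z (by norm_num)
          rwa [one_div] at this
      _ ≤ _ := by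
          apply add_le_add
          · refine hih.trans (le_of_eq ?_)
            congr 1
            apply Finset.sum_congr rfl
            intro i _
            rw [show s + 1 - (i + 1) = s - i by omega]
            congr 1
            apply Finset.sum_congr rfl
            intro j _
            rw [show (j + 1) * 2 ^ (i + 1) = 2 * ((j + 1) * 2 ^ i) by ring,
              show j * 2 ^ (i + 1) = 2 * (j * 2 ^ i) by ring]
          · rw [← aux_sqrt]
            gcongr ?_ ^ _
            calc ∑ j, z j ^ (2:ℝ) ≤ ∑ j, 2 * ∑ k ∈ Finset.Ico (l j) (h j),
                    ‖a (k + 1) - a k‖ₑ ^ (2:ℝ) := Finset.sum_le_sum fun j _ => hz2 j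
              _ ≤ _ := by
                rw [← Finset.mul_sum]
                simp only [pow_zero, mul_one, Nat.sub_zero]
                gcongr

/-- Lemma 2.1: for `r ≥ 2` and any sequence `(a_j)_{0 ≤ j ≤ 2^s}`,
`V_r(a_j : 0 ≤ j ≤ 2^s) ≤ √2 · ∑_{i=0}^{s} (∑_{j=0}^{2^{s-i}-1} |a_{(j+1)2^i} − a_{j2^i}|²)^{1/2}`. -/
theorem stmt_4 (r : ℝ) (hr : 2 ≤ r) (s : ℕ) (a : ℕ → ℂ) :
    vrOn r {j : ℕ | j ≤ 2 ^ s} a ≤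
      ENNReal.ofReal (Real.sqrt 2) *
        ∑ i ∈ Finset.range (s + 1),
          (∑ j ∈ Finset.range (2 ^ (s - i)),
              (‖a ((j + 1) * 2 ^ i) - a (j * 2 ^ i)‖₊ : ℝ≥0∞) ^ (2 : ℝ)) ^ ((2 : ℝ)⁻¹) := by
  unfold vrOn
  refine iSup_le fun J => iSup_le fun u => iSup_le fun hu => iSup_le fun hA => ?_
  refine (aux_lr _ r hr _).trans ?_
  refine aux_main s a (fun j : Fin J => u j.castSucc) (fun j => u j.succ) (fun j => ?_)
    (fun j => hA _) (fun i j hij => ?_)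
  · exact hu.monotone (Fin.castSucc_lt_succ).le
  · apply hu.monotone
    have h1 : (i : ℕ) < j := hij
    rw [Fin.le_def, Fin.val_succ, Fin.val_castSucc]
    omega
end

section
/- Let s ∈ ℕ₀ and let m, n be integers with 0 ≤ m < n ≤ 2^s. Then the integer interval [m, n) can be written as a finite disjoint union of dyadic intervals, i.e. intervals of the form [j·2^i, (j+1)·2^i) with 0 ≤ i ≤ s and 0 ≤ j ≤ 2^{s-i} − 1, each contained in [m, n), in such a way that for every i at most two intervals of length 2^i appear in the decomposition. -/
/-- left endpoint -/
def dyLo (p : ℕ × ℕ) : ℕ := p.2 * 2 ^ p.1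

/-- right endpoint -/
def dyHi (p : ℕ × ℕ) : ℕ := (p.2 + 1) * 2 ^ p.1

theorem dyadic_aux (n : ℕ) : ∀ m k : ℕ, m ≤ n → ∃ I : Finset (ℕ × ℕ),
    (∀ p ∈ I, k ≤ p.1 ∧ m * 2 ^ k ≤ dyLo p ∧ dyHi p ≤ n * 2 ^ k) ∧
    (∀ p ∈ I, ∀ q ∈ I, p ≠ q → dyHi p ≤ dyLo q ∨ dyHi q ≤ dyLo p) ∧
    (∀ x, m * 2 ^ k ≤ x → x < n * 2 ^ k → ∃ p ∈ I, dyLo p ≤ x ∧ x < dyHi p) ∧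
    (∀ i : ℕ, (I.filter fun p => p.1 = i).card ≤ 2) := by
  induction n using Nat.strong_induction_on with
  | _ n ih =>
  intro m k hmn
  rcases hmn.eq_or_lt with rfl | hlt
  · exact ⟨∅, by simp, by simp, fun x h1 h2 => by omega, by simp⟩
  obtain ⟨J, hJ, hd, hc, hcard⟩ := ih (n / 2) (by omega) ((m + 1) / 2) (k + 1) (by omega)
  have hA : (m % 2 = 0 ∧ (m + 1) / 2 * 2 ^ (k + 1) = m * 2 ^ k) ∨
      (m % 2 = 1 ∧ (m + 1) / 2 * 2 ^ (k + 1) = (m + 1) * 2 ^ k) := by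
    rcases Nat.mod_two_eq_zero_or_one m with h | h
    · left
      refine ⟨h, ?_⟩
      have : m = (m + 1) / 2 * 2 := by omega
      rw [pow_succ']; conv_rhs => rw [this]
      ring
    · right
      refine ⟨h, ?_⟩
      have : m + 1 = (m + 1) / 2 * 2 := by omega
      rw [pow_succ']; conv_rhs => rw [this]
      ring
  have hB : (n % 2 = 0 ∧ n / 2 * 2 ^ (k + 1) = n * 2 ^ k) ∨
      (n % 2 = 1 ∧ n / 2 * 2 ^ (k + 1) = (n - 1) * 2 ^ k) := by
    rcases Nat.mod_two_eq_zero_or_one n with h | h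
    · left
      refine ⟨h, ?_⟩
      have : n = n / 2 * 2 := by omega
      rw [pow_succ']; conv_rhs => rw [this]
      ring
    · right
      refine ⟨h, ?_⟩
      have : n - 1 = n / 2 * 2 := by omega
      rw [pow_succ', this]
      ring
  have hAB : (m + 1) / 2 * 2 ^ (k + 1) ≤ n / 2 * 2 ^ (k + 1) :=
    Nat.mul_le_mul_right _ (by omega)
  have hm1 : (m + 1) * 2 ^ k = m * 2 ^ k + 2 ^ k := by ring
  have hn1 : n * 2 ^ k = (n - 1) * 2 ^ k + 2 ^ k := by
    obtain ⟨b, rfl⟩ : ∃ b, n = b + 1 := ⟨n - 1, by omega⟩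
    simp; ring
  have hl1 : dyLo (k, m) = m * 2 ^ k := rfl
  have hl2 : dyHi (k, m) = (m + 1) * 2 ^ k := rfl
  have hr1 : dyLo (k, n - 1) = (n - 1) * 2 ^ k := rfl
  have hr2 : dyHi (k, n - 1) = n * 2 ^ k := by
    unfold dyHi
    simp only
    rw [Nat.sub_add_cancel (by omega)]
  generalize (m + 1) / 2 * 2 ^ (k + 1) = A' at *
  generalize n / 2 * 2 ^ (k + 1) = B' at *
  generalize (m + 1) * 2 ^ k = A1 at *
  generalize (n - 1) * 2 ^ k = B1 at *
  generalize m * 2 ^ k = A at *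
  generalize n * 2 ^ k = B at *
  generalize 2 ^ k = c at *
  obtain ⟨E, hE⟩ : ∃ E : Finset (ℕ × ℕ), E =
    ({(k, m), (k, n - 1)} : Finset (ℕ × ℕ)).filter
      (fun p => (p = (k, m) ∧ m % 2 = 1) ∨ (p = (k, n - 1) ∧ n % 2 = 1)) := ⟨_, rfl⟩
  have hEc : E.card ≤ 2 := by
    rw [hE]; exact (Finset.card_filter_le _ _).trans Finset.card_le_two
  have hEm : ∀ p, p ∈ E ↔ (p = (k, m) ∧ m % 2 = 1) ∨ (p = (k, n - 1) ∧ n % 2 = 1) := by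
    intro p; rw [hE]; simp only [Finset.mem_filter, Finset.mem_insert, Finset.mem_singleton]; tauto
  clear hE
  refine ⟨J ∪ E, ?_, ?_, ?_, ?_⟩
  · intro p hp
    rcases Finset.mem_union.1 hp with hp | hp
    · have := hJ p hp
      omega
    · rcases (hEm p).1 hp with ⟨rfl, h⟩ | ⟨rfl, h⟩
      · refine ⟨le_rfl, ?_⟩; omega
      · refine ⟨le_rfl, ?_⟩; omega
  · intro p hp q hq hpq
    rcases Finset.mem_union.1 hp with hp | hp <;> rcases Finset.mem_union.1 hq with hq | hq
    · exact hd p hp q hq hpq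
    · have := hJ p hp
      rcases (hEm q).1 hq with ⟨rfl, h⟩ | ⟨rfl, h⟩ <;> omega
    · have := hJ q hq
      rcases (hEm p).1 hp with ⟨rfl, h⟩ | ⟨rfl, h⟩ <;> omega
    · rcases (hEm p).1 hp with ⟨rfl, h⟩ | ⟨rfl, h⟩ <;>
        rcases (hEm q).1 hq with ⟨rfl, h'⟩ | ⟨rfl, h'⟩
      · exact absurd rfl hpq
      · omega
      · omega
      · exact absurd rfl hpq
  · intro x h1 h2
    by_cases hx1 : x < A'
    · exact ⟨(k, m), Finset.mem_union_right _ ((hEm _).2 (Or.inl ⟨rfl, by omega⟩)), by omega, by omega⟩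
    by_cases hx2 : x < B'
    · obtain ⟨p, hp, h⟩ := hc x (by omega) hx2
      exact ⟨p, Finset.mem_union_left _ hp, h⟩
    · exact ⟨(k, n - 1), Finset.mem_union_right _ ((hEm _).2 (Or.inr ⟨rfl, by omega⟩)),
        by omega, by omega⟩
  · intro i
    rw [Finset.filter_union]
    by_cases hi : i = k
    · have : J.filter (fun p => p.1 = i) = ∅ := by
        apply Finset.filter_eq_empty_iff.2
        intro p hp h
        have := (hJ p hp).1
        omega
      rw [this, Finset.empty_union]
      exact (Finset.card_filter_le _ _).trans hEc
    · have : E.filter (fun p => p.1 = i) = ∅ := by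
        apply Finset.filter_eq_empty_iff.2
        intro p hp h
        rcases (hEm p).1 hp with ⟨rfl, h'⟩ | ⟨rfl, h'⟩ <;> exact hi h.symm
      rw [this, Finset.union_empty]
      exact hcard i

/-- dyadic decomposition: for `0 ≤ m < n ≤ 2^s`, the integer interval
`[m, n)` is a finite disjoint union of dyadic intervals `[j·2^i, (j+1)·2^i)`
(with `0 ≤ i ≤ s`, `0 ≤ j ≤ 2^{s-i} − 1`), each contained in `[m, n)`, and such that for every
`i` at most two intervals of length `2^i` appear. Intervals are recorded as pairs `(i, j)`. -/
theorem stmt_5 (s m n : ℕ) (hmn : m < n) (hn : n ≤ 2 ^ s) :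
    ∃ I : Finset (ℕ × ℕ),
      (∀ p ∈ I, p.1 ≤ s ∧ p.2 + 1 ≤ 2 ^ (s - p.1)) ∧
      (∀ p ∈ I, Finset.Ico (p.2 * 2 ^ p.1) ((p.2 + 1) * 2 ^ p.1) ⊆ Finset.Ico m n) ∧
      (∀ p ∈ I, ∀ q ∈ I, p ≠ q →
        Disjoint (Finset.Ico (p.2 * 2 ^ p.1) ((p.2 + 1) * 2 ^ p.1))
          (Finset.Ico (q.2 * 2 ^ q.1) ((q.2 + 1) * 2 ^ q.1))) ∧
      (I.biUnion fun p => Finset.Ico (p.2 * 2 ^ p.1) ((p.2 + 1) * 2 ^ p.1)) = Finset.Ico m n ∧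
      (∀ i : ℕ, (I.filter fun p => p.1 = i).card ≤ 2) := by
  obtain ⟨I, hI, hd, hc, hcard⟩ := dyadic_aux n m 0 hmn.le
  simp only [pow_zero, mul_one] at hI hc
  refine ⟨I, ?_, ?_, ?_, ?_, hcard⟩
  · intro p hp
    have h : (p.2 + 1) * 2 ^ p.1 ≤ 2 ^ s := (hI p hp).2.2.trans hn
    have h1 : p.1 ≤ s := by
      apply (Nat.pow_le_pow_iff_right (a := 2) (by norm_num)).1
      exact (Nat.le_mul_of_pos_left _ (Nat.succ_pos _)).trans h
    refine ⟨h1, ?_⟩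
    rw [← Nat.sub_add_cancel h1, pow_add] at h
    exact Nat.le_of_mul_le_mul_right h (by positivity)
  · intro p hp
    exact Finset.Ico_subset_Ico (hI p hp).2.1 (hI p hp).2.2
  · intro p hp q hq hpq
    rw [Finset.disjoint_left]
    intro x hx hy
    have := hd p hp q hq hpq
    unfold dyLo dyHi at this
    rw [Finset.mem_Ico] at hx hy
    omega
  · ext x
    simp only [Finset.mem_biUnion, Finset.mem_Ico]
    constructor
    · rintro ⟨p, hp, h1, h2⟩
      exact ⟨(hI p hp).2.1.trans h1, h2.trans_le (hI p hp).2.2⟩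
    · rintro ⟨h1, h2⟩
      exact hc x h1 h2
end

section
/- There is an absolute constant C > 0 with the following property. Let u, v ∈ ℕ with u < v. For every integer h ∈ {1, …, v − u} there exists a strictly increasing sequence of integers (m_j)_{0 ≤ j ≤ h} with m₀ = u and m_h = v such that for every r ≥ 2 and every complex sequence (a_j)_{u ≤ j ≤ v}: V_r(a_j : u ≤ j ≤ v) ≤ C [ (Σ_{j=0}^{h} |a_{m_j}|²)^{1/2} + ((v−u)/h)^{1/2} (Σ_{j=u}^{v−1} |a_{j+1} − a_j|²)^{1/2} ]. -/
open scoped ENNReal NNReal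

lemma sum_rpow_le_rpow_sum_aux {ι : Type*} (A : Finset ι) (y : ι → ℝ≥0∞) (s : ℝ) (hs : 1 ≤ s) :
    ∑ i ∈ A, y i ^ s ≤ (∑ i ∈ A, y i) ^ s := by
  classical
  induction A using Finset.induction_on with
  | empty => simp
  | insert a A ha ih =>
    rw [Finset.sum_insert ha, Finset.sum_insert ha]
    exact (add_le_add le_rfl ih).trans (ENNReal.add_rpow_le_rpow_add _ _ hs)

lemma lr_le_l2_aux {ι : Type*} (A : Finset ι) (y : ι → ℝ≥0∞) (r : ℝ) (hr : 2 ≤ r) :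
    (∑ i ∈ A, y i ^ r) ^ r⁻¹ ≤ (∑ i ∈ A, y i ^ (2 : ℝ)) ^ (2 : ℝ)⁻¹ := by
  have hr0 : 0 < r := by linarith
  have h1 := sum_rpow_le_rpow_sum_aux A (fun i => y i ^ (2 : ℝ)) (r / 2) (by linarith)
  have h2 : ∀ i, (y i ^ (2 : ℝ)) ^ (r / 2) = y i ^ r := by
    intro i
    rw [← ENNReal.rpow_mul]
    congr 1
    ring
  simp only [h2] at h1
  calc _ ≤ ((∑ i ∈ A, y i ^ (2 : ℝ)) ^ (r / 2)) ^ r⁻¹ :=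
        ENNReal.rpow_le_rpow h1 (by positivity)
    _ = _ := by
        rw [← ENNReal.rpow_mul]
        congr 1
        field_simp

lemma diff_sq_aux (a : ℕ → ℂ) (s t : ℕ) (hst : s ≤ t) :
    ‖a t - a s‖ ^ 2 ≤ ((t : ℝ) - s) * ∑ j ∈ Finset.Ico s t, ‖a (j + 1) - a j‖ ^ 2 := by
  have h1 : ‖a t - a s‖ ≤ ∑ j ∈ Finset.Ico s t, ‖a (j + 1) - a j‖ := by
    rw [← Finset.sum_Ico_sub a hst]
    exact norm_sum_le _ _
  calc _ ≤ (∑ j ∈ Finset.Ico s t, ‖a (j + 1) - a j‖) ^ 2 := by gcongr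
    _ ≤ _ := by
      have := sq_sum_le_card_mul_sum_sq (s := Finset.Ico s t) (f := fun j => ‖a (j + 1) - a j‖)
      simpa [Nat.cast_sub hst] using this

lemma telescope_aux (J : ℕ) (g : Fin (J + 1) → ℝ) :
    ∑ j : Fin J, (g j.succ - g j.castSucc) = g (Fin.last J) - g 0 := by
  have h1 := Fin.sum_univ_succ g
  have h2 := Fin.sum_univ_castSucc g
  rw [Finset.sum_sub_distrib]
  linarith

/-- The nodes -/
lemma nodes_aux (u N h : ℕ) (hh : 1 ≤ h) (x : ℕ) (hu : u ≤ x) (hx : x ≤ u + N) :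
    ∃ j ≤ h, x ≤ u + j * N / h ∧ u + j * N / h < x + (N / h + 1) := by
  classical
  have hex : ∃ j, x ≤ u + j * N / h := ⟨h, by rw [Nat.mul_div_cancel_left _ hh]; exact hx⟩
  refine ⟨Nat.find hex, Nat.find_min' hex (by rw [Nat.mul_div_cancel_left _ hh]; exact hx),
    Nat.find_spec hex, ?_⟩
  rcases Nat.eq_zero_or_pos (Nat.find hex) with h0 | h0
  · rw [h0]
    have := Nat.zero_le (N / h)
    rw [zero_mul, Nat.zero_div]
    omega
  · have hm := Nat.find_min hex (m := Nat.find hex - 1) (by omega)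
    obtain ⟨k, hk⟩ : ∃ k, Nat.find hex = k + 1 := ⟨Nat.find hex - 1, by omega⟩
    rw [hk] at hm ⊢
    simp only [Nat.add_sub_cancel, not_le] at hm
    have : (k + 1) * N / h ≤ k * N / h + N / h + 1 := by
      rw [add_mul, one_mul]
      rw [Nat.add_div hh]
      split_ifs <;> omega
    omega

lemma step_aux (a : ℕ → ℂ) (M : Finset ℕ) (L u v s t : ℕ)
    (hM : ∀ x, u ≤ x → x ≤ v → ∃ p ∈ M, x ≤ p ∧ p < x + L)
    (hus : u ≤ s) (hst : s ≤ t) (htv : t ≤ v) :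
    ‖a t - a s‖ ^ 2 ≤ ∑ j ∈ Finset.Ico s t,
      (4 * (L : ℝ) * ‖a (j + 1) - a j‖ ^ 2 + 4 * (if j ∈ M then ‖a j‖ ^ 2 else 0)) := by
  rw [Finset.sum_add_distrib, ← Finset.mul_sum, ← Finset.mul_sum]
  set S := ∑ j ∈ Finset.Ico s t, ‖a (j + 1) - a j‖ ^ 2 with hS
  set T := ∑ j ∈ Finset.Ico s t, (if j ∈ M then ‖a j‖ ^ 2 else 0) with hT
  have hS0 : 0 ≤ S := Finset.sum_nonneg (fun _ _ => by positivity)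
  have hT0 : 0 ≤ T := Finset.sum_nonneg (fun _ _ => by split_ifs <;> positivity)
  have hL0 : (0 : ℝ) ≤ L := Nat.cast_nonneg _
  rcases Nat.lt_or_ge t (s + 2 * L) with hlt | hge
  · have h1 := diff_sq_aux a s t hst
    have h2 : (t : ℝ) - s ≤ 4 * L := by
      have : (t : ℝ) < s + 2 * L := by exact_mod_cast hlt
      linarith
    have h3 : ((t : ℝ) - s) * S ≤ 4 * L * S := by gcongr
    linarith
  · obtain ⟨p, hpM, hp1, hp2⟩ := hM s hus (by omega)
    obtain ⟨q, hqM, hq1, hq2⟩ := hM (t - L) (by omega) (by omega)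
    have hpq : p < q := by omega
    have hqt : q < t := by omega
    have d1 := diff_sq_aux a s p hp1
    have d2 := diff_sq_aux a q t hqt.le
    have c1 : (p : ℝ) - s ≤ L := by
      have : (p : ℝ) < s + L := by exact_mod_cast hp2
      linarith
    have c2 : (t : ℝ) - q ≤ L := by
      have : t ≤ q + L := by omega
      have : (t : ℝ) ≤ q + L := by exact_mod_cast this
      linarith
    have e : ∑ j ∈ Finset.Ico s p, ‖a (j + 1) - a j‖ ^ 2
        + ∑ j ∈ Finset.Ico q t, ‖a (j + 1) - a j‖ ^ 2 ≤ S := by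
      rw [hS, ← Finset.sum_Ico_consecutive _ hp1 (by omega : p ≤ t),
        ← Finset.sum_Ico_consecutive _ hpq.le hqt.le]
      have : 0 ≤ ∑ j ∈ Finset.Ico p q, ‖a (j + 1) - a j‖ ^ 2 :=
        Finset.sum_nonneg (fun _ _ => by positivity)
      linarith
    have f : ‖a p‖ ^ 2 + ‖a q‖ ^ 2 ≤ T := by
      have hsub : ({p, q} : Finset ℕ) ⊆ Finset.Ico s t := by
        intro x hx
        simp only [Finset.mem_insert, Finset.mem_singleton] at hx
        simp only [Finset.mem_Ico]
        omega
      have := Finset.sum_le_sum_of_subset_of_nonneg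
        (f := fun j => if j ∈ M then ‖a j‖ ^ 2 else 0) hsub
        (fun _ _ _ => by split_ifs <;> positivity)
      rw [Finset.sum_pair hpq.ne] at this
      rw [if_pos hpM, if_pos hqM] at this
      exact this
    have g1 : ‖a p - a s‖ ^ 2 ≤ L * ∑ j ∈ Finset.Ico s p, ‖a (j + 1) - a j‖ ^ 2 :=
      d1.trans (mul_le_mul_of_nonneg_right c1 (Finset.sum_nonneg (fun _ _ => by positivity)))
    have g2 : ‖a t - a q‖ ^ 2 ≤ L * ∑ j ∈ Finset.Ico q t, ‖a (j + 1) - a j‖ ^ 2 :=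
      d2.trans (mul_le_mul_of_nonneg_right c2 (Finset.sum_nonneg (fun _ _ => by positivity)))
    have g3 := mul_le_mul_of_nonneg_left e hL0
    have tri : ‖a t - a s‖ ≤ ‖a t - a q‖ + ‖a q‖ + ‖a p‖ + ‖a p - a s‖ := by
      have : a t - a s = (a t - a q) + a q - a p + (a p - a s) := by ring
      rw [this]
      refine (norm_add_le _ _).trans ?_
      gcongr
      refine (norm_sub_le _ _).trans ?_
      gcongr
      exact norm_add_le _ _
    have sq4 : ∀ x y z w : ℝ, (x + y + z + w) ^ 2 ≤ 4 * (x ^ 2 + y ^ 2 + z ^ 2 + w ^ 2) := by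
      intro x y z w
      nlinarith [sq_nonneg (x - y), sq_nonneg (x - z), sq_nonneg (x - w), sq_nonneg (y - z),
        sq_nonneg (y - w), sq_nonneg (z - w)]
    have := pow_le_pow_left₀ (norm_nonneg _) tri 2
    have := this.trans (sq4 _ _ _ _)
    nlinarith

lemma main_aux (a : ℕ → ℂ) (M : Finset ℕ) (L u v J : ℕ) (k : Fin (J + 1) → ℕ)
    (hM : ∀ x, u ≤ x → x ≤ v → ∃ p ∈ M, x ≤ p ∧ p < x + L)
    (hk : StrictMono k) (hkA : ∀ j, u ≤ k j ∧ k j ≤ v) :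
    ∑ j : Fin J, ‖a (k j.succ) - a (k j.castSucc)‖ ^ 2 ≤
      4 * (L : ℝ) * ∑ j ∈ Finset.Ico u v, ‖a (j + 1) - a j‖ ^ 2 + 4 * ∑ j ∈ M, ‖a j‖ ^ 2 := by
  set w : ℕ → ℝ := fun j =>
    4 * (L : ℝ) * ‖a (j + 1) - a j‖ ^ 2 + 4 * (if j ∈ M then ‖a j‖ ^ 2 else 0) with hw
  have hw0 : ∀ j, 0 ≤ w j := fun j => by
    simp only [hw]; split_ifs <;> positivity
  calc _ ≤ ∑ j : Fin J, (∑ i ∈ Finset.Ico u (k j.succ), w i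
            - ∑ i ∈ Finset.Ico u (k j.castSucc), w i) := by
        refine Finset.sum_le_sum fun j _ => ?_
        have hle : k j.castSucc ≤ k j.succ := (hk Fin.castSucc_lt_succ).le
        have h1 := step_aux a M L u v _ _ hM (hkA j.castSucc).1 hle (hkA j.succ).2
        rw [← Finset.sum_Ico_consecutive w (hkA j.castSucc).1 hle]
        linarith
    _ = ∑ i ∈ Finset.Ico u (k (Fin.last J)), w i - ∑ i ∈ Finset.Ico u (k 0), w i :=
        telescope_aux J (fun j => ∑ i ∈ Finset.Ico u (k j), w i)
    _ ≤ ∑ i ∈ Finset.Ico u (k (Fin.last J)), w i := by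
        linarith [Finset.sum_nonneg (s := Finset.Ico u (k 0)) (fun i _ => hw0 i)]
    _ ≤ ∑ i ∈ Finset.Ico u v, w i :=
        Finset.sum_le_sum_of_subset_of_nonneg
          (Finset.Ico_subset_Ico_right (hkA _).2) (fun i _ _ => hw0 i)
    _ ≤ _ := by
        simp only [hw]
        rw [Finset.sum_add_distrib, ← Finset.mul_sum, ← Finset.mul_sum, ← Finset.sum_filter]
        gcongr
        intro x hx
        exact (Finset.mem_filter.1 hx).2

lemma nnnorm_sq_aux (z : ℂ) : (‖z‖₊ : ℝ≥0∞) ^ (2 : ℝ) = ENNReal.ofReal (‖z‖ ^ 2) := by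
  rw [ENNReal.ofReal_pow (norm_nonneg _), ofReal_norm, enorm_eq_nnnorm]
  norm_cast

/-- Lemma 2.2: there is an absolute constant `C > 0` such that for all
`u < v` and every integer `h ∈ {1, …, v − u}` there is a strictly increasing sequence
`(m_j)_{0 ≤ j ≤ h}` with `m 0 = u`, `m h = v`, such that for every `r ≥ 2` and every complex
sequence `a`:
`V_r(a_j : u ≤ j ≤ v) ≤ C [ (∑_{j≤h} |a_{m_j}|²)^{1/2} + ((v−u)/h)^{1/2} (∑_{j=u}^{v−1} |a_{j+1}−a_j|²)^{1/2} ]`. -/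
theorem stmt_6 :
    ∃ C : ℝ, 0 < C ∧
      ∀ u v : ℕ, u < v → ∀ h : ℕ, 1 ≤ h → h ≤ v - u →
        ∃ m : ℕ → ℕ, StrictMonoOn m (Set.Iic h) ∧ m 0 = u ∧ m h = v ∧
          ∀ r : ℝ, 2 ≤ r → ∀ a : ℕ → ℂ,
            vrOn r {j : ℕ | u ≤ j ∧ j ≤ v} a ≤
              ENNReal.ofReal C *
                ((∑ j ∈ Finset.range (h + 1), (‖a (m j)‖₊ : ℝ≥0∞) ^ (2 : ℝ)) ^ ((2 : ℝ)⁻¹) +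
                  (ENNReal.ofReal (((v : ℝ) - (u : ℝ)) / (h : ℝ))) ^ ((2 : ℝ)⁻¹) *
                    (∑ j ∈ Finset.Ico u v,
                        (‖a (j + 1) - a j‖₊ : ℝ≥0∞) ^ (2 : ℝ)) ^ ((2 : ℝ)⁻¹)) := by
  refine ⟨3, by norm_num, ?_⟩
  intro u v huv h hh hle
  have hgap : ∀ i, i * (v - u) / h < (i + 1) * (v - u) / h := by
    intro i
    rw [add_mul, one_mul, Nat.lt_iff_add_one_le, ← Nat.add_div_right _ hh]
    exact Nat.div_le_div_right (by omega)
  have hsm : StrictMono (fun j => u + j * (v - u) / h) :=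
    strictMono_nat_of_lt_succ fun i => Nat.add_lt_add_left (hgap i) u
  refine ⟨fun j => u + j * (v - u) / h, hsm.strictMonoOn _, by simp, ?_, ?_⟩
  · simp only
    rw [Nat.mul_div_cancel_left _ hh]; omega
  intro r hr a
  unfold vrOn
  refine iSup_le fun J => iSup_le fun k => iSup_le fun hk => iSup_le fun hkA => ?_
  refine (lr_le_l2_aux _ _ r hr).trans ?_
  simp only [nnnorm_sq_aux]
  have key := main_aux a ((Finset.range (h + 1)).image (fun j => u + j * (v - u) / h))
    ((v - u) / h + 1) u v J k (by
      intro x hx hx'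
      obtain ⟨j, hj, h1, h2⟩ := nodes_aux u (v - u) h hh x hx (by omega)
      exact ⟨_, Finset.mem_image.2 ⟨j, by simp; omega, rfl⟩, h1, h2⟩) hk hkA
  rw [Finset.sum_image (fun x _ y _ hxy => hsm.injective hxy)] at key
  rw [← ENNReal.ofReal_sum_of_nonneg (fun _ _ => by positivity),
    ← ENNReal.ofReal_sum_of_nonneg (fun _ _ => by positivity),
    ← ENNReal.ofReal_sum_of_nonneg (fun _ _ => by positivity)]
  set S := ∑ j ∈ Finset.Ico u v, ‖a (j + 1) - a j‖ ^ 2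
  set T := ∑ j ∈ Finset.range (h + 1), ‖a (u + j * (v - u) / h)‖ ^ 2
  set X := ∑ j : Fin J, ‖a (k j.succ) - a (k j.castSucc)‖ ^ 2
  have hS0 : 0 ≤ S := Finset.sum_nonneg (fun _ _ => by positivity)
  have hT0 : 0 ≤ T := Finset.sum_nonneg (fun _ _ => by positivity)
  have hX0 : 0 ≤ X := Finset.sum_nonneg (fun _ _ => by positivity)
  have hh0 : (0 : ℝ) < h := by exact_mod_cast hh
  have hQ1 : 1 ≤ ((v : ℝ) - u) / h := by
    rw [one_le_div hh0, ← Nat.cast_sub huv.le]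
    exact_mod_cast hle
  have hQ2 : (((v - u) / h : ℕ) : ℝ) ≤ ((v : ℝ) - u) / h := by
    rw [← Nat.cast_sub huv.le]
    exact Nat.cast_div_le
  set Q := ((v : ℝ) - u) / h
  have hQ0 : 0 ≤ Q := by linarith
  have hb : X ≤ 8 * (Q * S) + 4 * T := by
    push_cast at key
    have : 4 * ((((v - u) / h : ℕ) : ℝ) + 1) * S ≤ 4 * (Q + Q) * S := by gcongr
    linarith
  rw [ENNReal.ofReal_rpow_of_nonneg hX0 (by norm_num),
    ENNReal.ofReal_rpow_of_nonneg hT0 (by norm_num),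
    ENNReal.ofReal_rpow_of_nonneg hQ0 (by norm_num),
    ENNReal.ofReal_rpow_of_nonneg hS0 (by norm_num),
    ← ENNReal.ofReal_mul (by positivity), ← ENNReal.ofReal_add (by positivity) (by positivity),
    ← ENNReal.ofReal_mul (by positivity)]
  apply ENNReal.ofReal_le_ofReal
  rw [show ((2 : ℝ)⁻¹) = 1 / 2 by norm_num]
  simp only [← Real.sqrt_eq_rpow]
  apply Real.sqrt_le_iff.2
  refine ⟨by positivity, hb.trans ?_⟩
  rw [← Real.sqrt_mul hQ0]
  have hP0 : 0 ≤ Q * S := by positivity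
  nlinarith [Real.sq_sqrt hP0, Real.sq_sqrt hT0, Real.sqrt_nonneg (Q * S), Real.sqrt_nonneg T,
    mul_nonneg (Real.sqrt_nonneg (Q * S)) (Real.sqrt_nonneg T)]
end
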